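/- arXiv:math/0605236 — 2 statements merged into one kernel-verified Lean document; each statement's English description precedes it below -/
import Mathlib

section
/- Let R be a commutative ring, H a bialgebra over R with comultiplication Δ, and π : H → H a bialgebra homomorphism with π∘π = π. Let Ψ ∈ H⊗H be invertible, set Ψ₂ := (π⊗id)(Ψ), assume Ψ₂ is invertible, and set Ψ₁ := Ψ·Ψ₂^{−1}. Assume: (a) Ψ₂ satisfies the cocycle equation (Ψ₂⊗1)·((Δ⊗id)(Ψ₂)) = (1⊗Ψ₂)·((id⊗Δ)(Ψ₂)) in H⊗H⊗H; (b) (1⊗Ψ₁)·(Ψ₂⊗1) = (Ψ₂⊗1)·(1⊗Ψ₁); (c) (π⊗id⊗id)((Δ⊗id)(Ψ₁)) = 1⊗Ψ₁; (d) there exists an invertible ω ∈ H such that the element Ψ_ω := (ω⊗ω)·Ψ·Δ(ω^{−1}) satisfies (π⊗id)(Ψ_ω) = Ψ_ω. Then Ψ satisfies the cocycle equation (Ψ⊗1)·((Δ⊗id)(Ψ)) = (1⊗Ψ)·((id⊗Δ)(Ψ)), i.e. Ψ is a twist. -/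
open scoped TensorProduct

noncomputable section

variable (R H : Type*) [CommRing R] [Ring H] [Bialgebra R H]

/-- `F ↦ F ⊗ 1` : the embedding of `H ⊗ H` into legs `(1,2)` of `H ⊗ H ⊗ H`. -/
def inc12 : H ⊗[R] H →ₗ[R] H ⊗[R] (H ⊗[R] H) :=
  TensorProduct.map LinearMap.id ((TensorProduct.mk R H H).flip (1 : H))

/-- `F ↦ 1 ⊗ F` : the embedding of `H ⊗ H` into legs `(2,3)` of `H ⊗ H ⊗ H`. -/
def inc23 : H ⊗[R] H →ₗ[R] H ⊗[R] (H ⊗[R] H) :=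
  TensorProduct.mk R H (H ⊗[R] H) (1 : H)

/-- `(Δ ⊗ id) : H ⊗ H → H ⊗ H ⊗ H`. -/
def delta12 : H ⊗[R] H →ₗ[R] H ⊗[R] (H ⊗[R] H) :=
  (TensorProduct.assoc R H H H).toLinearMap.comp
    (TensorProduct.map Coalgebra.comul LinearMap.id)

/-- `(id ⊗ Δ) : H ⊗ H → H ⊗ H ⊗ H`. -/
def delta23 : H ⊗[R] H →ₗ[R] H ⊗[R] (H ⊗[R] H) :=
  TensorProduct.map LinearMap.id Coalgebra.comul

variable {R H}

/-- `(π ⊗ id) : H ⊗ H → H ⊗ H` induced by a bialgebra map `π`. -/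
def piT (π : H →ₐc[R] H) : H ⊗[R] H →ₗ[R] H ⊗[R] H :=
  TensorProduct.map π.toLinearMap LinearMap.id

/-- `(π ⊗ id ⊗ id) : H ⊗ H ⊗ H → H ⊗ H ⊗ H`. -/
def piT3 (π : H →ₐc[R] H) : H ⊗[R] (H ⊗[R] H) →ₗ[R] H ⊗[R] (H ⊗[R] H) :=
  TensorProduct.map π.toLinearMap LinearMap.id

lemma inc12_tmul (a b : H) : inc12 R H (a ⊗ₜ b) = a ⊗ₜ (b ⊗ₜ 1) := rfl

lemma inc23_apply (x : H ⊗[R] H) : inc23 R H x = 1 ⊗ₜ x := rfl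

lemma inc12_mul (x y : H ⊗[R] H) : inc12 R H (x * y) = inc12 R H x * inc12 R H y :=
  map_mul (Algebra.TensorProduct.map (AlgHom.id R H)
    (Algebra.TensorProduct.includeLeft : H →ₐ[R] H ⊗[R] H)) x y

lemma inc23_mul (x y : H ⊗[R] H) : inc23 R H (x * y) = inc23 R H x * inc23 R H y :=
  map_mul (Algebra.TensorProduct.includeRight : H ⊗[R] H →ₐ[R] H ⊗[R] (H ⊗[R] H)) x y

lemma delta12_mul (x y : H ⊗[R] H) :
    delta12 R H (x * y) = delta12 R H x * delta12 R H y :=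
  map_mul ((Algebra.TensorProduct.assoc R R R H H H).toAlgHom.comp
    (Algebra.TensorProduct.map (Bialgebra.comulAlgHom R H) (AlgHom.id R H))) x y

lemma delta23_mul (x y : H ⊗[R] H) :
    delta23 R H (x * y) = delta23 R H x * delta23 R H y :=
  map_mul (Algebra.TensorProduct.map (AlgHom.id R H) (Bialgebra.comulAlgHom R H)) x y

lemma piT3_mul (π : H →ₐc[R] H) (x y : H ⊗[R] (H ⊗[R] H)) :
    piT3 π (x * y) = piT3 π x * piT3 π y :=
  map_mul (Algebra.TensorProduct.map (π : H →ₐ[R] H) (AlgHom.id R (H ⊗[R] H))) x y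

lemma inc12_one : inc12 R H 1 = 1 := rfl

lemma inc23_one : inc23 R H 1 = 1 := rfl

lemma delta12_one : delta12 R H 1 = 1 :=
  map_one ((Algebra.TensorProduct.assoc R R R H H H).toAlgHom.comp
    (Algebra.TensorProduct.map (Bialgebra.comulAlgHom R H) (AlgHom.id R H)))

lemma piT3_inc12 (π : H →ₐc[R] H) (x : H ⊗[R] H) :
    piT3 π (inc12 R H x) = inc12 R H (piT π x) := by
  induction x with
  | zero => simp
  | tmul a b => rfl
  | add x y hx hy => simp [hx, hy]

lemma piT3_inc23 (π : H →ₐc[R] H) (x : H ⊗[R] H) :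
    piT3 π (inc23 R H x) = inc23 R H x := by
  rw [inc23_apply]
  exact congrArg (· ⊗ₜ[R] x) (map_one π)

lemma piT3_delta23 (π : H →ₐc[R] H) (x : H ⊗[R] H) :
    piT3 π (delta23 R H x) = delta23 R H (piT π x) := by
  induction x with
  | zero => simp
  | tmul a b => rfl
  | add x y hx hy => simp [hx, hy]

lemma piT_comul (π : H →ₐc[R] H) (hπ : ∀ x, π (π x) = π x) (a : H) :
    piT π (Coalgebra.comul (π a)) = Coalgebra.comul (R := R) (π a) := by
  rw [← CoalgHomClass.map_comp_comul_apply]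
  generalize Coalgebra.comul (R := R) a = z
  induction z with
  | zero => simp
  | tmul a b => exact congrArg (· ⊗ₜ[R] π b) (hπ a)
  | add x y hx hy => simp only [map_add, hx, hy]

lemma piT3_assoc_tmul (π : H →ₐc[R] H) (z : H ⊗[R] H) (b : H) :
    piT3 π (TensorProduct.assoc R H H H (z ⊗ₜ b)) =
      TensorProduct.assoc R H H H (piT π z ⊗ₜ b) := by
  induction z with
  | zero => simp
  | tmul a c => rfl
  | add x y hx hy => simp [TensorProduct.add_tmul, hx, hy]

lemma piT3_delta12_piT (π : H →ₐc[R] H) (hπ : ∀ x, π (π x) = π x) (x : H ⊗[R] H) :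
    piT3 π (delta12 R H (piT π x)) = delta12 R H (piT π x) := by
  induction x with
  | zero => simp
  | tmul a b =>
    change piT3 π (TensorProduct.assoc R H H H (Coalgebra.comul (π a) ⊗ₜ b)) =
      TensorProduct.assoc R H H H (Coalgebra.comul (π a) ⊗ₜ b)
    rw [piT3_assoc_tmul, piT_comul π hπ]
  | add x y hx hy => simp [hx, hy]

lemma delta12_comul (a : H) :
    delta12 R H (Coalgebra.comul a) = delta23 R H (Coalgebra.comul a) :=
  Coalgebra.coassoc_apply a

lemma delta12_tmul (a b : H) :
    delta12 R H (a ⊗ₜ b) = inc12 R H (Coalgebra.comul a) * (1 ⊗ₜ (1 ⊗ₜ b)) := by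
  change TensorProduct.assoc R H H H (Coalgebra.comul a ⊗ₜ b) = _
  generalize Coalgebra.comul (R := R) a = z
  induction z with
  | zero => simp
  | tmul a c => simp [inc12_tmul]
  | add x y hx hy => simp [TensorProduct.add_tmul, hx, hy, add_mul]

lemma delta23_tmul (a b : H) :
    delta23 R H (a ⊗ₜ b) = inc23 R H (Coalgebra.comul b) * (a ⊗ₜ 1) := by
  change a ⊗ₜ[R] Coalgebra.comul (R := R) b = _
  simp [inc23_apply]

lemma inc12_mul_comm (x : H ⊗[R] H) (b : H) :
    inc12 R H x * (1 ⊗ₜ (1 ⊗ₜ b)) = (1 ⊗ₜ (1 ⊗ₜ b)) * inc12 R H x := by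
  induction x with
  | zero => simp
  | tmul a c => simp [inc12_tmul]
  | add x y hx hy => simp [hx, hy, add_mul, mul_add]

lemma inc23_mul_comm (x : H ⊗[R] H) (a : H) :
    inc23 R H x * (a ⊗ₜ 1) = (a ⊗ₜ 1) * inc23 R H x := by
  simp [inc23_apply]

/-- The two sides of the cocycle equation transform in the same way under the gauge
transformation `Ψ ↦ (ω ⊗ ω) Ψ Δ(ω⁻¹)`; this is the left-hand side. -/
lemma inc12_mul_delta12_gauge (Ψ : H ⊗[R] H) {ω ωInv : H} (h : ωInv * ω = 1) :
    inc12 R H ((ω ⊗ₜ[R] ω) * Ψ * Coalgebra.comul ωInv) *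
        delta12 R H ((ω ⊗ₜ[R] ω) * Ψ * Coalgebra.comul ωInv) =
      (ω ⊗ₜ (ω ⊗ₜ ω)) * (inc12 R H Ψ * delta12 R H Ψ) *
        delta12 R H (Coalgebra.comul ωInv) := by
  have hΔ : inc12 R H (Coalgebra.comul ωInv) * inc12 R H (Coalgebra.comul ω) = 1 := by
    rw [← inc12_mul, ← Bialgebra.comul_mul, h, Bialgebra.comul_one, inc12_one]
  have hω : (ω ⊗ₜ[R] (ω ⊗ₜ[R] ω)) = inc12 R H (ω ⊗ₜ ω) * (1 ⊗ₜ (1 ⊗ₜ ω)) := by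
    simp [inc12_tmul]
  simp only [inc12_mul, delta12_mul, delta12_tmul, hω]
  simp only [mul_assoc]
  rw [← mul_assoc (inc12 R H (Coalgebra.comul ωInv)), hΔ, one_mul,
    ← mul_assoc (inc12 R H Ψ) (1 ⊗ₜ (1 ⊗ₜ ω)), inc12_mul_comm]
  simp only [mul_assoc]

/-- The two sides of the cocycle equation transform in the same way under the gauge
transformation `Ψ ↦ (ω ⊗ ω) Ψ Δ(ω⁻¹)`; this is the right-hand side. -/
lemma inc23_mul_delta23_gauge (Ψ : H ⊗[R] H) {ω ωInv : H} (h : ωInv * ω = 1) :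
    inc23 R H ((ω ⊗ₜ[R] ω) * Ψ * Coalgebra.comul ωInv) *
        delta23 R H ((ω ⊗ₜ[R] ω) * Ψ * Coalgebra.comul ωInv) =
      (ω ⊗ₜ (ω ⊗ₜ ω)) * (inc23 R H Ψ * delta23 R H Ψ) *
        delta23 R H (Coalgebra.comul ωInv) := by
  have hΔ : inc23 R H (Coalgebra.comul ωInv) * inc23 R H (Coalgebra.comul ω) = 1 := by
    rw [← inc23_mul, ← Bialgebra.comul_mul, h, Bialgebra.comul_one, inc23_one]
  have hω : (ω ⊗ₜ[R] (ω ⊗ₜ[R] ω)) = inc23 R H (ω ⊗ₜ ω) * (ω ⊗ₜ 1) := by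
    simp [inc23_apply]
  simp only [inc23_mul, delta23_mul, delta23_tmul, hω]
  simp only [mul_assoc]
  rw [← mul_assoc (inc23 R H (Coalgebra.comul ωInv)), hΔ, one_mul,
    ← mul_assoc (inc23 R H Ψ) (ω ⊗ₜ 1), inc23_mul_comm]
  simp only [mul_assoc]

/-- The abstract ω-affinization theorem.  Let `π : H → H` be an idempotent
bialgebra map, `Ψ ∈ H ⊗ H` invertible, `Ψ₂ := (π⊗id)(Ψ)` invertible (with
inverse `Ψ₂Inv`) and `Ψ₁ := Ψ·Ψ₂⁻¹`.  If
(a) `Ψ₂` satisfies the cocycle equation,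
(b) `(1⊗Ψ₁)·(Ψ₂⊗1) = (Ψ₂⊗1)·(1⊗Ψ₁)`,
(c) `(π⊗id⊗id)((Δ⊗id)(Ψ₁)) = 1⊗Ψ₁`, and
(d) there is an invertible `ω ∈ H` with `(π⊗id)(Ψ_ω) = Ψ_ω`, where
    `Ψ_ω := (ω⊗ω)·Ψ·Δ(ω⁻¹)`,
then `Ψ` satisfies the cocycle equation
`(Ψ⊗1)·((Δ⊗id)(Ψ)) = (1⊗Ψ)·((id⊗Δ)(Ψ))`, i.e. `Ψ` is a twist. -/
theorem statement7 {R H : Type*} [CommRing R] [Ring H] [Bialgebra R H]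
    (π : H →ₐc[R] H) (hπ : ∀ x, π (π x) = π x)
    (Ψ ΨInv : H ⊗[R] H) (hΨr : Ψ * ΨInv = 1) (hΨl : ΨInv * Ψ = 1)
    (Ψ₂Inv : H ⊗[R] H) (hΨ₂r : piT π Ψ * Ψ₂Inv = 1) (hΨ₂l : Ψ₂Inv * piT π Ψ = 1)
    (ha : inc12 R H (piT π Ψ) * delta12 R H (piT π Ψ)
        = inc23 R H (piT π Ψ) * delta23 R H (piT π Ψ))
    (hb : inc23 R H (Ψ * Ψ₂Inv) * inc12 R H (piT π Ψ)
        = inc12 R H (piT π Ψ) * inc23 R H (Ψ * Ψ₂Inv))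
    (hc : piT3 π (delta12 R H (Ψ * Ψ₂Inv)) = inc23 R H (Ψ * Ψ₂Inv))
    (hd : ∃ ω ωInv : H, ω * ωInv = 1 ∧ ωInv * ω = 1 ∧
        piT π ((ω ⊗ₜ[R] ω) * Ψ * Coalgebra.comul ωInv)
          = (ω ⊗ₜ[R] ω) * Ψ * Coalgebra.comul ωInv) :
    inc12 R H Ψ * delta12 R H Ψ = inc23 R H Ψ * delta23 R H Ψ := by
  obtain ⟨ω, ωInv, hω, hω', hinv⟩ := hd
  have hΨ : Ψ * Ψ₂Inv * piT π Ψ = Ψ := by rw [mul_assoc, hΨ₂l, mul_one]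
  have hP : piT3 π (inc12 R H Ψ * delta12 R H Ψ) = piT3 π (inc23 R H Ψ * delta23 R H Ψ) := by
    have h12 : piT3 π (delta12 R H Ψ) =
        inc23 R H (Ψ * Ψ₂Inv) * delta12 R H (piT π Ψ) := by
      rw [← hc, ← piT3_delta12_piT π hπ Ψ, ← piT3_mul, ← delta12_mul, hΨ]
    rw [piT3_mul, piT3_mul, piT3_inc12, piT3_inc23, piT3_delta23, h12, ← mul_assoc, ← hb,
      mul_assoc, ha, ← mul_assoc, ← inc23_mul, hΨ]
  have hgauge₁ := inc12_mul_delta12_gauge Ψ hω'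
  have hgauge₂ := inc23_mul_delta23_gauge Ψ hω'
  rw [← delta12_comul] at hgauge₂
  set Ψω := (ω ⊗ₜ[R] ω) * Ψ * Coalgebra.comul ωInv
  have hfix₁ : piT3 π (inc12 R H Ψω * delta12 R H Ψω) = inc12 R H Ψω * delta12 R H Ψω := by
    have h := piT3_delta12_piT π hπ Ψω
    rw [hinv] at h
    rw [piT3_mul, piT3_inc12, hinv, h]
  have hfix₂ : piT3 π (inc23 R H Ψω * delta23 R H Ψω) = inc23 R H Ψω * delta23 R H Ψω := by
    rw [piT3_mul, piT3_inc23, piT3_delta23, hinv]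
  have heq : (ω ⊗ₜ[R] (ω ⊗ₜ[R] ω)) * (inc12 R H Ψ * delta12 R H Ψ) *
        delta12 R H (Coalgebra.comul ωInv) =
      (ω ⊗ₜ[R] (ω ⊗ₜ[R] ω)) * (inc23 R H Ψ * delta23 R H Ψ) *
        delta12 R H (Coalgebra.comul ωInv) := by
    rw [← hgauge₁, ← hgauge₂, ← hfix₁, ← hfix₂, hgauge₁, hgauge₂]
    simp only [piT3_mul] at hP ⊢
    rw [hP]
  have hunit : IsUnit (ω ⊗ₜ[R] (ω ⊗ₜ[R] ω)) :=
    ⟨⟨ω ⊗ₜ[R] (ω ⊗ₜ[R] ω), ωInv ⊗ₜ[R] (ωInv ⊗ₜ[R] ωInv),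
      by simp only [Algebra.TensorProduct.tmul_mul_tmul, hω, Algebra.TensorProduct.one_def],
      by simp only [Algebra.TensorProduct.tmul_mul_tmul, hω', Algebra.TensorProduct.one_def]⟩,
      rfl⟩
  have hunit' : IsUnit (delta12 R H (Coalgebra.comul ωInv)) :=
    ⟨⟨_, delta12 R H (Coalgebra.comul ω),
      by rw [← delta12_mul, ← Bialgebra.comul_mul, hω', Bialgebra.comul_one, delta12_one],
      by rw [← delta12_mul, ← Bialgebra.comul_mul, hω, Bialgebra.comul_one, delta12_one]⟩,
      rfl⟩
  exact hunit.mul_left_cancel (hunit'.mul_right_cancel heq)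

end
end

section
/- Let R be a commutative ring, H a bialgebra over R with comultiplication Δ, and π : H → H a bialgebra homomorphism with π∘π = π. Let Ψ ∈ H⊗H be invertible, set Ψ₂ := (π⊗id)(Ψ), assume Ψ₂ is invertible, and set Ψ₁ := Ψ·Ψ₂^{−1}. Assume there exists an invertible ω ∈ H such that Ψ_ω := (ω⊗ω)·Ψ·Δ(ω^{−1}) satisfies (π⊗id)(Ψ_ω) = Ψ_ω. Then Ψ₁ = ((ω^{−1}·π(ω))⊗1) · Ψ₂ · ((π⊗id)(Δ(ω^{−1}))) · Δ(ω) · Ψ₂^{−1} in H⊗H. -/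
open scoped TensorProduct

noncomputable section

variable (R H : Type*) [CommRing R] [Ring H] [Bialgebra R H]

variable {R H}

theorem piT_mul {R H : Type*} [CommRing R] [Ring H] [Bialgebra R H] (π : H →ₐc[R] H)
    (x y : H ⊗[R] H) : piT π (x * y) = piT π x * piT π y :=
  map_mul (Algebra.TensorProduct.map (π : H →ₐ[R] H) (AlgHom.id R H)) x y

theorem piT_tmul {R H : Type*} [CommRing R] [Ring H] [Bialgebra R H] (π : H →ₐc[R] H)
    (a b : H) : piT π (a ⊗ₜ[R] b) = π a ⊗ₜ[R] b :=
  rfl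

/-- Corollary to the ω-affinization theorem: with `Ψ₂ := (π⊗id)(Ψ)` and
`Ψ₁ := Ψ·Ψ₂⁻¹`, if `ω` is invertible and `Ψ_ω := (ω⊗ω)·Ψ·Δ(ω⁻¹)` satisfies
`(π⊗id)(Ψ_ω) = Ψ_ω`, then
`Ψ₁ = ((ω⁻¹·π(ω))⊗1) · Ψ₂ · ((π⊗id)(Δ(ω⁻¹))) · Δ(ω) · Ψ₂⁻¹`. -/
theorem statement8 {R H : Type*} [CommRing R] [Ring H] [Bialgebra R H]
    (π : H →ₐc[R] H) (hπ : ∀ x, π (π x) = π x)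
    (Ψ ΨInv : H ⊗[R] H) (hΨr : Ψ * ΨInv = 1) (hΨl : ΨInv * Ψ = 1)
    (Ψ₂Inv : H ⊗[R] H) (hΨ₂r : piT π Ψ * Ψ₂Inv = 1) (hΨ₂l : Ψ₂Inv * piT π Ψ = 1)
    (ω ωInv : H) (hωr : ω * ωInv = 1) (hωl : ωInv * ω = 1)
    (hd : piT π ((ω ⊗ₜ[R] ω) * Ψ * Coalgebra.comul ωInv)
        = (ω ⊗ₜ[R] ω) * Ψ * Coalgebra.comul ωInv) :
    Ψ * Ψ₂Inv
      = ((ωInv * π ω) ⊗ₜ[R] (1 : H)) * piT π Ψ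
          * piT π (Coalgebra.comul ωInv) * Coalgebra.comul ω * Ψ₂Inv := by
  have hΔ : (Coalgebra.comul ωInv : H ⊗[R] H) * Coalgebra.comul ω = 1 := by
    rw [← Bialgebra.comul_mul, hωl, Bialgebra.comul_one]
  have hinv : (ωInv ⊗ₜ[R] ωInv) * (ω ⊗ₜ[R] ω) = (1 : H ⊗[R] H) := by
    rw [Algebra.TensorProduct.tmul_mul_tmul, hωl, Algebra.TensorProduct.one_def]
  have hleg : (ωInv ⊗ₜ[R] ωInv) * (π ω ⊗ₜ[R] ω) = (ωInv * π ω) ⊗ₜ[R] (1 : H) := by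
    rw [Algebra.TensorProduct.tmul_mul_tmul, hωl]
  rw [piT_mul, piT_mul, piT_tmul] at hd
  have hΨ : Ψ = (ωInv ⊗ₜ[R] ωInv) * ((ω ⊗ₜ[R] ω) * Ψ * Coalgebra.comul ωInv)
      * Coalgebra.comul ω := by
    rw [mul_assoc, mul_assoc, hΔ, mul_one, ← mul_assoc, hinv, one_mul]
  rw [← hd] at hΨ
  rw [← hleg]
  conv_lhs => rw [hΨ]
  simp only [mul_assoc]

end
end
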